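/- Combining the four exact sequences 0 → κ → m → n_ξ → 0, 0 → n_ξ → n → Hom(W',E) → 0, 0 → h^{E^⊥} → κ → Hom(W',E) → 0, and 0 → s → z_h(s) → h^{E^⊥} → 0, one obtains the dimension identity dim M − dim Z_H(S) + dim S = dim N, where M ≅ GL(W) × H, S is a maximal k-torus of H (k = dim W) with centralizer Z_H(S), and N is the unipotent radical. -/

import Mathlib

section

variable (F : Type*) [Field F]
variable (W W' X : Type*)
variable [AddCommGroup W] [Module F W] [AddCommGroup W'] [Module F W']
variable [AddCommGroup X] [Module F X]

/-- The Lie algebra `𝔥` of `H = Isom(X, Φ)`: skew operators `B` (`B* = −B`). -/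
def isomLie (Φ : X →ₗ[F] X →ₗ[F] F) : Submodule F (X →ₗ[F] X) where
  carrier := {B | ∀ x y : X, Φ (B x) y + Φ x (B y) = 0}
  zero_mem' := by intro x y; simp
  add_mem' := by
    intro B C hB hC x y
    simp only [LinearMap.add_apply, map_add, LinearMap.add_apply]
    linear_combination hB x y + hC x y
  smul_mem' := by
    intro c B hB x y
    simp only [LinearMap.smul_apply, map_smul, LinearMap.smul_apply, smul_eq_mul]
    linear_combination c * hB x y

/-- `𝔥^{E^⊥} = {B ∈ 𝔥 : B|_{E^⊥} = 0}` where `E = ker ξ`. -/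
def isomLieEperp (Φ : X →ₗ[F] X →ₗ[F] F) (ξ : X →ₗ[F] W) :
    Submodule F (X →ₗ[F] X) where
  carrier := {B | (∀ x y : X, Φ (B x) y + Φ x (B y) = 0) ∧
      ∀ x : X, (∀ y ∈ LinearMap.ker ξ, Φ x y = 0) → B x = 0}
  zero_mem' := ⟨by intro x y; simp, by intro x _; simp⟩
  add_mem' := by
    intro B C hB hC
    refine ⟨?_, ?_⟩
    · intro x y
      simp only [LinearMap.add_apply, map_add, LinearMap.add_apply]
      linear_combination hB.1 x y + hC.1 x y
    · intro x hx
      simp [LinearMap.add_apply, hB.2 x hx, hC.2 x hx]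
  smul_mem' := by
    intro c B hB
    refine ⟨?_, ?_⟩
    · intro x y
      simp only [LinearMap.smul_apply, map_smul, LinearMap.smul_apply, smul_eq_mul]
      linear_combination c * hB.1 x y
    · intro x hx
      simp [LinearMap.smul_apply, hB.2 x hx]

/-- The Lie algebra `𝔫` of the unipotent radical `N`: pairs `u(A₀, B₀)` with
`B₀* + B₀ = 0`, expressed via the pairing `Bp` and the sign `ε`. -/
def unipLie (ε : F) (Bp : W' →ₗ[F] W →ₗ[F] F) :
    Submodule F ((X →ₗ[F] W) × (W' →ₗ[F] W)) where
  carrier := {p | ∀ w₁' w₂' : W', Bp w₁' (p.2 w₂') + ε * Bp w₂' (p.2 w₁') = 0}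
  zero_mem' := by intro w₁' w₂'; simp
  add_mem' := by
    intro p q hp hq w₁' w₂'
    simp only [Prod.snd_add, LinearMap.add_apply, map_add]
    linear_combination hp w₁' w₂' + hq w₁' w₂'
  smul_mem' := by
    intro c p hp w₁' w₂'
    simp only [Prod.smul_snd, LinearMap.smul_apply, map_smul, smul_eq_mul]
    linear_combination c * hp w₁' w₂'

end

/-- Bilinear forms `b` on `V` with `b x y + ε b y x = 0`. -/
def skewForms (F : Type*) [Field F] (V : Type*) [AddCommGroup V] [Module F V] (ε : F) :
    Submodule F (V →ₗ[F] V →ₗ[F] F) where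
  carrier := {b | ∀ x y : V, b x y + ε * b y x = 0}
  zero_mem' := by intro x y; simp
  add_mem' := by
    intro B C hB hC x y
    simp only [LinearMap.add_apply]
    linear_combination hB x y + hC x y
  smul_mem' := by
    intro c B hB x y
    simp only [LinearMap.smul_apply, smul_eq_mul]
    linear_combination c * hB x y

/-- The map `𝔫 → Hom(X, W) × skewForms W'`. -/
def unipMap (F : Type*) [Field F] (W W' X : Type*)
    [AddCommGroup W] [Module F W] [AddCommGroup W'] [Module F W']
    [AddCommGroup X] [Module F X] (ε : F) (Bp : W' →ₗ[F] W →ₗ[F] F) :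
    ↥(unipLie F W W' X ε Bp) →ₗ[F] (X →ₗ[F] W) × ↥(skewForms F W' ε) where
  toFun p := (p.1.1, ⟨Bp.compl₂ p.1.2, fun x y => p.2 x y⟩)
  map_add' p q := by
    ext <;> simp
  map_smul' c p := by
    ext <;> simp

/-- The map `𝔥 → Hom(W', E*) × skewForms W'`. -/
def isomMap (F : Type*) [Field F] (W' X : Type*)
    [AddCommGroup W'] [Module F W']
    [AddCommGroup X] [Module F X] (ε : F) (Φ : X →ₗ[F] X →ₗ[F] F)
    (hΦε : ∀ x y : X, Φ x y = ε * Φ y x) (E : Submodule F X) (ξs : W' →ₗ[F] X) :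
    ↥(isomLie F X Φ) →ₗ[F] (W' →ₗ[F] ↥E →ₗ[F] F) × ↥(skewForms F W' ε) where
  toFun B := ((Φ ∘ₗ B.1 ∘ₗ ξs).compl₂ E.subtype,
    ⟨(Φ ∘ₗ B.1 ∘ₗ ξs).compl₂ ξs, fun x y => by
      have h := B.2 (ξs x) (ξs y)
      have h2 := hΦε (ξs x) (B.1 (ξs y))
      simp only [LinearMap.compl₂_apply, LinearMap.comp_apply]
      linear_combination h - h2⟩)
  map_add' p q := by
    ext <;> simp
  map_smul' c p := by
    ext <;> simp

/-- The dimension identity `dim M − dim Z_H(S) + dim S = dim N` (in subtraction-free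
form `dim M + dim S = dim N + dim Z_H(S)`), where `M ≅ GL(W) × H`, `S` is a maximal
`k`-torus of `H` (`k = dim W`) with centralizer `Z_H(S)`, whose Lie algebra `𝔷`
decomposes as `𝔥^{E^⊥} ⊕ 𝔰` with `E = X^S = ker ξ`, and `N` is the unipotent
radical. -/
theorem dimension_identity
    (F : Type*) [Field F] (hchar : (2 : F) ≠ 0)
    (W W' X : Type*)
    [AddCommGroup W] [Module F W] [FiniteDimensional F W]
    [AddCommGroup W'] [Module F W'] [FiniteDimensional F W']
    [AddCommGroup X] [Module F X] [FiniteDimensional F X]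
    (ε : F) (hε : ε = 1 ∨ ε = -1)
    (Bp : W' →ₗ[F] W →ₗ[F] F)
    (hBp1 : ∀ w' : W', (∀ w : W, Bp w' w = 0) → w' = 0)
    (hBp2 : ∀ w : W, (∀ w' : W', Bp w' w = 0) → w = 0)
    (hdim : Module.finrank F W' = Module.finrank F W)
    (Φ : X →ₗ[F] X →ₗ[F] F)
    (hΦnd : ∀ x : X, (∀ y : X, Φ x y = 0) → x = 0)
    (hΦε : ∀ x y : X, Φ x y = ε * Φ y x)
    (ξ : X →ₗ[F] W) (hξsurj : Function.Surjective ξ)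
    (hEnd : ∀ x ∈ LinearMap.ker ξ, (∀ y ∈ LinearMap.ker ξ, Φ x y = 0) → x = 0)
    (ξs : W' →ₗ[F] X)
    (hξs : ∀ (w' : W') (x : X), Φ (ξs w') x = Bp w' (ξ x))
    (𝔰 𝔷 : Submodule F (X →ₗ[F] X))
    (h𝔰 : 𝔰 ≤ isomLie F X Φ)
    (h𝔷 : 𝔷 = isomLieEperp F W X Φ ξ ⊔ 𝔰)
    (hdisj : Disjoint (isomLieEperp F W X Φ ξ) 𝔰) :
    Module.finrank F (W →ₗ[F] W) + Module.finrank F ↥(isomLie F X Φ)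
        + Module.finrank F ↥𝔰 =
      Module.finrank F ↥(unipLie F W W' X ε Bp) + Module.finrank F ↥𝔷 := by
  have hε2 : ε * ε = 1 := by rcases hε with h | h <;> simp [h]
  -- ξs is injective, ξ ∘ ξs is bijective
  have hinj : ∀ w' : W', ξs w' = 0 → w' = 0 := by
    intro w' h
    apply hBp1
    intro w
    obtain ⟨x, rfl⟩ := hξsurj w
    rw [← hξs, h]; simp
  have hcinj : Function.Injective (ξ ∘ₗ ξs) := by
    rw [injective_iff_map_eq_zero]
    intro w' h
    apply hinj
    apply hEnd _ h
    intro y hy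
    rw [hξs, LinearMap.mem_ker.1 hy, map_zero]
  let e : W' ≃ₗ[F] W := LinearEquiv.ofInjectiveOfFinrankEq (ξ ∘ₗ ξs) hcinj hdim
  have he : ∀ w', e w' = ξ (ξs w') := fun w' => rfl
  let r : X →ₗ[F] W' := e.symm.toLinearMap ∘ₗ ξ
  have hr : ∀ x, ξ (ξs (r x)) = ξ x := by
    intro x
    rw [← he]; simp [r]
  have hrs : ∀ w', r (ξs w') = w' := by
    intro w'
    apply hcinj
    simpa using hr (ξs w')
  have hrE : ∀ x ∈ LinearMap.ker ξ, r x = 0 := by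
    intro x hx
    simp [r, LinearMap.mem_ker.1 hx]
  let q : X →ₗ[F] ↥(LinearMap.ker ξ) :=
    (LinearMap.id - ξs ∘ₗ r).codRestrict _ (fun x => by simp [hr])
  have hq : ∀ x, (q x : X) = x - ξs (r x) := fun x => rfl
  have hqs : ∀ w', q (ξs w') = 0 := by
    intro w'
    apply Subtype.ext
    simp [hq, hrs]
  have hqE : ∀ x : ↥(LinearMap.ker ξ), q x = x := by
    intro x
    apply Subtype.ext
    simp [hq, hrE x x.2]
  have hperp : ∀ x, (∀ y ∈ LinearMap.ker ξ, Φ x y = 0) → x = ξs (r x) := by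
    intro x hx
    have := hEnd (q x) (q x).2 (fun y hy => by
      rw [hq, map_sub, LinearMap.sub_apply, hx y hy, hξs, LinearMap.mem_ker.1 hy]; simp)
    rw [hq] at this
    exact sub_eq_zero.1 this
  -- Φ as an equivalence
  have hΦinj : Function.Injective Φ := by
    rw [injective_iff_map_eq_zero]
    intro x h
    exact hΦnd x (fun y => by rw [h]; rfl)
  let eΦ : X ≃ₗ[F] (X →ₗ[F] F) :=
    LinearEquiv.ofInjectiveOfFinrankEq Φ hΦinj (Subspace.dual_finrank_eq (K := F) (V := X)).symm
  have heΦ : ∀ f x, Φ (eΦ.symm f) x = f x := by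
    intro f x
    have : eΦ (eΦ.symm f) = f := eΦ.apply_symm_apply f
    exact congrArg (fun g => g x) this
  -- Bp.flip as an equivalence
  have hBinj : Function.Injective Bp.flip := by
    rw [injective_iff_map_eq_zero]
    intro x h
    exact hBp2 x (fun y => by rw [← LinearMap.flip_apply, h]; rfl)
  let eB : W ≃ₗ[F] (W' →ₗ[F] F) :=
    LinearEquiv.ofInjectiveOfFinrankEq Bp.flip hBinj
      (hdim.symm.trans (Subspace.dual_finrank_eq (K := F) (V := W')).symm)
  have heB : ∀ f x, Bp x (eB.symm f) = f x := by
    intro f x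
    have : eB (eB.symm f) = f := eB.apply_symm_apply f
    exact congrArg (fun g => g x) this
  have hfree : Module.Free F ↥(skewForms F W' ε) :=
    @Module.Free.of_divisionRing F ↥(skewForms F W' ε) Field.toDivisionRing
      (@Submodule.addCommGroup F (W' →ₗ[F] W' →ₗ[F] F) _ _ LinearMap.module
        (skewForms F W' ε)) (Submodule.module (skewForms F W' ε))
  have hn : Module.finrank F ↥(unipLie F W W' X ε Bp) =
      Module.finrank F X * Module.finrank F W + Module.finrank F ↥(skewForms F W' ε) := by
    have hbij : Function.Bijective (unipMap F W W' X ε Bp) := by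
      constructor
      · rw [injective_iff_map_eq_zero]
        intro p hp
        have h1 : p.1.1 = 0 := congrArg Prod.fst hp
        have h2 : Bp.compl₂ p.1.2 = 0 := congrArg (fun z => z.2.1) hp
        apply Subtype.ext
        refine Prod.ext h1 ?_
        refine LinearMap.ext fun w' => ?_
        apply hBp2
        intro w1
        exact congrArg (fun b => b w1 w') h2
      · rintro ⟨A, b⟩
        refine ⟨⟨(A, eB.symm.toLinearMap ∘ₗ b.1.flip), ?_⟩, ?_⟩
        · intro x y
          simp only [LinearMap.comp_apply, LinearEquiv.coe_coe, heB, LinearMap.flip_apply]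
          exact b.2 x y
        · refine Prod.ext rfl (Subtype.ext ?_)
          refine LinearMap.ext fun x => LinearMap.ext fun y => ?_
          exact heB _ _
    rw [(LinearEquiv.ofBijective _ hbij).finrank_eq, Module.finrank_prod, Module.finrank_linearMap]
  -- dimension of 𝔥
  let T := isomMap F W' X ε Φ hΦε (LinearMap.ker ξ) ξs
  have hTsurj : Function.Surjective T := by
    rintro ⟨g, a⟩
    let c : X →ₗ[F] X →ₗ[F] F := (g ∘ₗ r).compl₂ q
    let b : X →ₗ[F] X →ₗ[F] F := c - ε • c.flip + (a.1 ∘ₗ r).compl₂ r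
    have hb : ∀ x y, b x y = g (r x) (q y) - ε * g (r y) (q x) + a.1 (r x) (r y) :=
      fun x y => rfl
    have hB : ∀ x y, Φ (eΦ.symm (b x)) y = b x y := fun x y => heΦ _ _
    refine ⟨⟨eΦ.symm.toLinearMap ∘ₗ b, ?_⟩, ?_⟩
    · intro x y
      simp only [LinearMap.comp_apply, LinearEquiv.coe_coe]
      rw [hΦε x, hB, hB, hb, hb]
      have := a.2 (r x) (r y)
      linear_combination this - g (r x) (q y) * hε2
    · refine Prod.ext ?_ (Subtype.ext ?_)
      · refine LinearMap.ext fun x => LinearMap.ext fun y => ?_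
        refine (hB (ξs x) y).trans ?_
        rw [hb, hrs, hqs, hqE, hrE y y.2]
        simp
      · refine LinearMap.ext fun x => LinearMap.ext fun y => ?_
        refine (hB (ξs x) (ξs y)).trans ?_
        rw [hb, hrs, hqs, hrs, hqs]
        simp
  have hle : isomLieEperp F W X Φ ξ ≤ isomLie F X Φ := fun B hB => hB.1
  have hker : LinearMap.ker T = (isomLieEperp F W X Φ ξ).comap (isomLie F X Φ).subtype := by
    ext B
    rw [LinearMap.mem_ker, Submodule.mem_comap]
    constructor
    · intro h
      refine ⟨B.2, fun x hx => ?_⟩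
      have h1 : ∀ w' (y : ↥(LinearMap.ker ξ)), Φ (B.1 (ξs w')) y = 0 := fun w' y =>
        congrArg (fun z => z.1 w' y) h
      have h2 : ∀ w' w2, Φ (B.1 (ξs w')) (ξs w2) = 0 := fun w' w2 =>
        congrArg (fun z => z.2.1 w' w2) h
      rw [hperp x hx]
      apply hΦnd
      intro y
      have hy : y = (q y : X) + ξs (r y) := by rw [hq]; abel
      rw [hy, map_add]
      have e1 := h1 (r x) (q y)
      have e2 := h2 (r x) (r y)
      simp only [Submodule.subtype_apply]
      rw [e1, e2, add_zero]
    · intro h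
      have h0 : ∀ w', B.1 (ξs w') = 0 := fun w' => h.2 _ (fun y hy => by
        rw [hξs, LinearMap.mem_ker.1 hy, map_zero])
      refine Prod.ext ?_ (Subtype.ext ?_)
      · refine LinearMap.ext fun x => LinearMap.ext fun y => ?_
        change Φ (B.1 (ξs x)) y = 0
        rw [h0]; simp
      · refine LinearMap.ext fun x => LinearMap.ext fun y => ?_
        change Φ (B.1 (ξs x)) (ξs y) = 0
        rw [h0]; simp
  have hkdim : Module.finrank F ↥(LinearMap.ker T) =
      Module.finrank F ↥(isomLieEperp F W X Φ ξ) := by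
    rw [hker]
    exact (Submodule.comapSubtypeEquivOfLe hle).finrank_eq
  have hrn := @LinearMap.finrank_range_add_finrank_ker F ↥(isomLie F X Φ) _
    (Submodule.addCommGroup (isomLie F X Φ)) (Submodule.module (isomLie F X Φ))
    ((W' →ₗ[F] ↥(LinearMap.ker ξ) →ₗ[F] F) × ↥(skewForms F W' ε))
    (@Prod.instAddCommGroup _ _ _ (@Submodule.addCommGroup F (W' →ₗ[F] W' →ₗ[F] F) _ _ LinearMap.module
        (skewForms F W' ε))) _ _ T
  rw [LinearMap.range_eq_top.2 hTsurj, finrank_top, Module.finrank_prod, hkdim,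
    Module.finrank_linearMap, Module.finrank_linearMap, Module.finrank_self, mul_one] at hrn
  have hE := LinearMap.finrank_range_add_finrank_ker ξ
  rw [LinearMap.range_eq_top.2 hξsurj, finrank_top] at hE
  have hz := Submodule.finrank_sup_add_finrank_inf_eq (isomLieEperp F W X Φ ξ) 𝔰
  rw [hdisj.eq_bot, finrank_bot, add_zero, ← h𝔷] at hz
  rw [hn, hz, ← hrn, ← hE, Module.finrank_linearMap, hdim]
  ring
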